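/- arXiv:0912.5492 — 6 statements merged into one kernel-verified Lean document; each statement's English description precedes it below -/
import Mathlib

section
/- Let U ⊆ ℝ^N be open and let μ^1, ..., μ^N : U → ℝ be smooth functions such that μ^i(u) ≠ μ^j(u) for all u ∈ U and all i ≠ j. Consider the diagonal affinor w^i_j(u) = μ^i(u) δ^i_j. Then the Nijenhuis tensor of w vanishes identically on U if and only if ∂μ^i/∂u^j = 0 on U for all i and all j ≠ i (i.e., each eigenvalue μ^i depends only on the coordinate u^i). -/
/-- Partial derivative `∂f/∂u^j` of a scalar function on `ℝ^N`. -/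
noncomputable def pd {N : ℕ} (f : (Fin N → ℝ) → ℝ) (j : Fin N) (u : Fin N → ℝ) : ℝ :=
  fderiv ℝ f u (Pi.single j 1)

/-- The Nijenhuis tensor `N^k_{ij}` of an affinor `v^i_j(u)` on `ℝ^N`. -/
noncomputable def nijenhuisT {N : ℕ} (v : (Fin N → ℝ) → Matrix (Fin N) (Fin N) ℝ)
    (k i j : Fin N) (u : Fin N → ℝ) : ℝ :=
  ∑ s, (v u s i * pd (fun w => v w k j) s u - v u s j * pd (fun w => v w k i) s u +
        v u k s * pd (fun w => v w s i) j u - v u k s * pd (fun w => v w s j) i u)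

theorem pd_diag_aux {N : ℕ} (μ : Fin N → (Fin N → ℝ) → ℝ) (a b s : Fin N) (u : Fin N → ℝ) :
    pd (fun w => (Matrix.diagonal fun s => μ s w) a b) s u = if a = b then pd (μ a) s u else 0 := by
  by_cases h : a = b
  · subst h
    simp [pd]
  · simp [pd, Matrix.diagonal_apply, h]

theorem nij_diag_aux {N : ℕ} (μ : Fin N → (Fin N → ℝ) → ℝ) (k i j : Fin N) (u : Fin N → ℝ) :
    nijenhuisT (fun w => Matrix.diagonal fun s => μ s w) k i j u =
      (if k = j then (μ i u - μ k u) * pd (μ k) i u else 0) -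
      (if k = i then (μ j u - μ k u) * pd (μ k) j u else 0) := by
  unfold nijenhuisT
  simp only [pd_diag_aux]
  simp only [Matrix.diagonal_apply, Finset.sum_add_distrib, Finset.sum_sub_distrib,
    ite_mul, zero_mul, Finset.sum_ite_eq, Finset.sum_ite_eq', Finset.mem_univ, if_true]
  split_ifs <;> ring

/-- **Lemma 2, part 1.** For a diagonal affinor `w^i_j(u) = μ^i(u) δ^i_j` with pairwise distinct
eigenvalues on an open set `U`, the Nijenhuis tensor vanishes identically on `U` iff each
eigenvalue `μ^i` depends only on the coordinate `u^i`, i.e. `∂μ^i/∂u^j = 0` on `U` for `j ≠ i`. -/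
theorem nijenhuis_of_distinct_diagonal_affinor_vanishes_iff {N : ℕ}
    (U : Set (Fin N → ℝ)) (hU : IsOpen U)
    (μ : Fin N → (Fin N → ℝ) → ℝ)
    (hμsm : ∀ i, ContDiffOn ℝ (⊤ : ℕ∞) (μ i) U)
    (hdist : ∀ u ∈ U, ∀ i j : Fin N, i ≠ j → μ i u ≠ μ j u) :
    (∀ u ∈ U, ∀ k i j : Fin N,
        nijenhuisT (fun w => Matrix.diagonal fun s => μ s w) k i j u = 0) ↔
      (∀ i j : Fin N, j ≠ i → ∀ u ∈ U, pd (μ i) j u = 0) := by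
  simp only [nij_diag_aux]
  constructor
  · intro h i j hji u hu
    have h1 := h u hu i j i
    rw [if_pos rfl, if_neg (Ne.symm hji), sub_zero] at h1
    exact (mul_eq_zero.mp h1).resolve_left (sub_ne_zero.mpr (hdist u hu j i hji))
  · intro h u hu k i j
    have key : ∀ a, (μ a u - μ k u) * pd (μ k) a u = 0 := by
      intro a
      by_cases hak : a = k
      · subst hak
        simp
      · rw [h k a hak u hu, mul_zero]
    simp [key]
end

section
/- Let U ⊆ ℝ^N be open, let g_1, ..., g_N : U → ℝ be smooth nowhere-vanishing functions, and let V^1, ..., V^N : U → ℝ be smooth functions with V^i(u) ≠ V^j(u) for every u ∈ U and all i ≠ j. Assume that ∂V^i/∂u^j = ( (∂g_i/∂u^j) / (2 g_i) ) (V^j − V^i) holds on U for all i ≠ j. Then for all pairwise distinct indices i, j, k, the semi-Hamiltonian relation ∂/∂u^k ( (1/(V^j − V^i)) ∂V^i/∂u^j ) = ∂/∂u^j ( (1/(V^k − V^i)) ∂V^i/∂u^k ) holds on U. -/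
theorem pd_comm_aux {N : ℕ} (f : (Fin N → ℝ) → ℝ) (u : Fin N → ℝ)
    (hf : ContDiffAt ℝ 2 f u) (j k : Fin N) :
    pd (pd f j) k u = pd (pd f k) j u := by
  have hs : IsSymmSndFDerivAt ℝ f u := hf.isSymmSndFDerivAt (by simp)
  have hd : DifferentiableAt ℝ (fderiv ℝ f) u :=
    (hf.fderiv_right (m := 1) (by norm_num)).differentiableAt (by norm_num)
  have key : ∀ a b : Fin N, pd (pd f a) b u
      = fderiv ℝ (fderiv ℝ f) u (Pi.single b 1) (Pi.single a 1) := by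
    intro a b
    have h := hd.hasFDerivAt.clm_apply (hasFDerivAt_const (Pi.single a (1:ℝ) : Fin N → ℝ) u)
    have h2 : HasFDerivAt (pd f a) _ u := h
    rw [pd, h2.fderiv]
    simp
  rw [key, key]
  exact hs _ _

/-- If the eigenvalues `V^i` of a strictly hyperbolic diagonal system satisfy the Hamiltonian
relation `∂V^i/∂u^j = ((∂g_i/∂u^j)/(2 g_i)) (V^j − V^i)` for `i ≠ j` (with `g_i` nowhere
vanishing), then they satisfy the semi-Hamiltonian relation
`∂/∂u^k((1/(V^j − V^i)) ∂V^i/∂u^j) = ∂/∂u^j((1/(V^k − V^i)) ∂V^i/∂u^k)` for pairwise distinct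
`i, j, k`. -/
theorem hamiltonian_relation_implies_semiHamiltonian {N : ℕ}
    (U : Set (Fin N → ℝ)) (hU : IsOpen U)
    (g : Fin N → (Fin N → ℝ) → ℝ)
    (hgsm : ∀ i, ContDiffOn ℝ (⊤ : ℕ∞) (g i) U)
    (hg0 : ∀ i, ∀ u ∈ U, g i u ≠ 0)
    (V : Fin N → (Fin N → ℝ) → ℝ)
    (hVsm : ∀ i, ContDiffOn ℝ (⊤ : ℕ∞) (V i) U)
    (hVdist : ∀ u ∈ U, ∀ i j : Fin N, i ≠ j → V i u ≠ V j u)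
    (hrel : ∀ u ∈ U, ∀ i j : Fin N, i ≠ j →
      pd (V i) j u = (pd (g i) j u / (2 * g i u)) * (V j u - V i u)) :
    ∀ u ∈ U, ∀ i j k : Fin N, i ≠ j → j ≠ k → i ≠ k →
      pd (fun v => (1 / (V j v - V i v)) * pd (V i) j v) k u =
        pd (fun v => (1 / (V k v - V i v)) * pd (V i) k v) j u := by
  intro u hu i j k hij hjk hik
  have hgat : ∀ v ∈ U, ContDiffAt ℝ 2 (g i) v := fun v hv =>
    ((hgsm i).contDiffAt (hU.mem_nhds hv)).of_le (WithTop.coe_le_coe.2 (le_top : (2 : ℕ∞) ≤ ⊤))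
  have hphi : ContDiffAt ℝ 2 (fun v => (1 / 2 : ℝ) * Real.log (g i v)) u :=
    contDiffAt_const.mul ((hgat u hu).log (hg0 i u hu))
  have key : ∀ a : Fin N, i ≠ a →
      (fun v => (1 / (V a v - V i v)) * pd (V i) a v) =ᶠ[nhds u]
        pd (fun v => (1 / 2 : ℝ) * Real.log (g i v)) a := by
    intro a hia
    filter_upwards [hU.mem_nhds hu] with v hv
    have hd : DifferentiableAt ℝ (g i) v := (hgat v hv).differentiableAt (by norm_num)
    have h := (hd.hasFDerivAt.log (hg0 i v hv)).const_mul (1 / 2 : ℝ)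
    have hne : V a v - V i v ≠ 0 := sub_ne_zero.2 (hVdist v hv i a hia).symm
    have hg := hg0 i v hv
    have e : pd (fun v => (1 / 2 : ℝ) * Real.log (g i v)) a v
        = (1 / 2) * ((g i v)⁻¹ * pd (g i) a v) := by
      rw [pd, h.fderiv]
      simp [pd]
    rw [e, hrel v hv i a hia]
    field_simp
  have h1 := (key j hij).fderiv_eq (𝕜 := ℝ)
  have h2 := (key k hik).fderiv_eq (𝕜 := ℝ)
  have h3 := pd_comm_aux _ u hphi j k
  rw [pd, h1, pd, h2]
  exact h3
end

section
/- Let W ⊆ ℝ² be open with coordinates (u², u³), let f : W → ℝ be smooth, and define Φ : ℝ × W → ℝ by Φ(u¹, u², u³) = ½ (u¹)² u³ + ½ u¹ (u²)² + f(u², u³). Let η be the 3×3 antidiagonal matrix with η^{13} = η^{22} = η^{31} = 1 and all other entries 0 (which equals its own inverse). Then Φ satisfies the WDVV associativity equations Σ_{k,l} Φ_{ijk} η^{kl} Φ_{lmn} = Σ_{k,l} Φ_{imk} η^{kl} Φ_{ljn} for all indices i, j, m, n on ℝ × W if and only if f satisfies the Dubrovin equation ∂³f/∂(u³)³ = ( ∂³f/∂(u²)²∂u³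 )² − ( ∂³f/∂(u²)³ )( ∂³f/∂u²∂(u³)² ) on W. -/
/-- Third partial derivative `∂³Φ/∂u^i∂u^j∂u^k`. -/
noncomputable def d3 {N : ℕ} (Φ : (Fin N → ℝ) → ℝ) (i j k : Fin N) (u : Fin N → ℝ) : ℝ :=
  pd (fun v => pd (fun w => pd Φ k w) j v) i u

/-- Partial derivative with respect to the first coordinate (`u²`) on `ℝ²`. -/
noncomputable def pdx (f : ℝ × ℝ → ℝ) (p : ℝ × ℝ) : ℝ := fderiv ℝ f p (1, 0)

/-- Partial derivative with respect to the second coordinate (`u³`) on `ℝ²`. -/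
noncomputable def pdt (f : ℝ × ℝ → ℝ) (p : ℝ × ℝ) : ℝ := fderiv ℝ f p (0, 1)

open Topology in
lemma pd_congr' {N : ℕ} {F G : (Fin N → ℝ) → ℝ} {u : Fin N → ℝ} (h : F =ᶠ[𝓝 u] G) (j : Fin N) :
    pd F j u = pd G j u := by
  unfold pd; rw [h.fderiv_eq]

/-- the three induced directional derivatives on the plane -/
noncomputable def dd (j : Fin 3) (g : ℝ × ℝ → ℝ) : ℝ × ℝ → ℝ :=
  ![fun _ => 0, pdx g, pdt g] j

lemma dd_eq (j : Fin 3) (g : ℝ × ℝ → ℝ) (p : ℝ × ℝ) :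
    dd j g p = fderiv ℝ g p ((Pi.single j 1 : Fin 3 → ℝ) 1, (Pi.single j 1 : Fin 3 → ℝ) 2) := by
  fin_cases j <;> simp [dd, pdx, pdt]
  exact (map_zero (fderiv ℝ g p)).symm

lemma dd_congr {W : Set (ℝ × ℝ)} (hW : IsOpen W) {g h : ℝ × ℝ → ℝ}
    (e : ∀ p ∈ W, g p = h p) (j : Fin 3) : ∀ p ∈ W, dd j g p = dd j h p := by
  intro p hp
  have : g =ᶠ[nhds p] h := Filter.eventuallyEq_of_mem (hW.mem_nhds hp) e
  rw [dd_eq, dd_eq, this.fderiv_eq]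

lemma dd_smooth {W : Set (ℝ × ℝ)} (hW : IsOpen W) {g : ℝ × ℝ → ℝ}
    (hg : ContDiffOn ℝ (⊤ : ℕ∞) g W) (j : Fin 3) : ContDiffOn ℝ (⊤ : ℕ∞) (dd j g) W := by
  have h1 : ContDiffOn ℝ (⊤ : ℕ∞) (fderiv ℝ g) W := hg.fderiv_of_isOpen hW (by simp)
  have : dd j g = fun p => fderiv ℝ g p
      ((Pi.single j 1 : Fin 3 → ℝ) 1, (Pi.single j 1 : Fin 3 → ℝ) 2) := funext (dd_eq j g)
  rw [this]
  exact h1.clm_apply contDiffOn_const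

lemma dd_comm {W : Set (ℝ × ℝ)} (hW : IsOpen W) {g : ℝ × ℝ → ℝ}
    (hg : ContDiffOn ℝ (⊤ : ℕ∞) g W) (i j : Fin 3) :
    ∀ p ∈ W, dd i (dd j g) p = dd j (dd i g) p := by
  intro p hp
  have h1 : ContDiffOn ℝ (⊤ : ℕ∞) (fderiv ℝ g) W := hg.fderiv_of_isOpen hW (by simp)
  have hd : DifferentiableAt ℝ (fderiv ℝ g) p :=
    (h1.contDiffAt (hW.mem_nhds hp)).differentiableAt (by simp)
  have hs : IsSymmSndFDerivAt ℝ g p :=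
    (hg.contDiffAt (hW.mem_nhds hp)).isSymmSndFDerivAt (by
      rw [minSmoothness_of_isRCLikeNormedField]; exact WithTop.coe_le_coe.2 le_top)
  have key : ∀ a b : Fin 3, dd a (dd b g) p = fderiv ℝ (fderiv ℝ g) p
      ((Pi.single a 1 : Fin 3 → ℝ) 1, (Pi.single a 1 : Fin 3 → ℝ) 2)
      ((Pi.single b 1 : Fin 3 → ℝ) 1, (Pi.single b 1 : Fin 3 → ℝ) 2) := by
    intro a b
    have : dd b g = fun p => fderiv ℝ g p
      ((Pi.single b 1 : Fin 3 → ℝ) 1, (Pi.single b 1 : Fin 3 → ℝ) 2) := funext (dd_eq b g)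
    rw [dd_eq, this, fderiv_clm_apply hd (differentiableAt_const _)]
    simp
  rw [key, key]
  exact hs _ _

lemma pd_add_comp {W : Set (ℝ × ℝ)} (hW : IsOpen W) {g : ℝ × ℝ → ℝ}
    (hg : ContDiffOn ℝ (⊤ : ℕ∞) g W) {P : (Fin 3 → ℝ) → ℝ} (hP : Differentiable ℝ P)
    (j : Fin 3) (u : Fin 3 → ℝ) (hu : (u 1, u 2) ∈ W) :
    pd (fun u => P u + g (u 1, u 2)) j u = pd P j u + dd j g (u 1, u 2) := by
  have hgd : DifferentiableAt ℝ g (u 1, u 2) :=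
    (hg.contDiffAt (hW.mem_nhds hu)).differentiableAt (by simp)
  have hL : HasFDerivAt (fun u : Fin 3 → ℝ => (u 1, u 2))
      ((ContinuousLinearMap.proj (R := ℝ) (φ := fun _ : Fin 3 => ℝ) 1).prod
        (ContinuousLinearMap.proj (R := ℝ) (φ := fun _ : Fin 3 => ℝ) 2)) u :=
    ((ContinuousLinearMap.proj (R := ℝ) (φ := fun _ : Fin 3 => ℝ) 1).prod
        (ContinuousLinearMap.proj (R := ℝ) (φ := fun _ : Fin 3 => ℝ) 2)).hasFDerivAt
  have hc := HasFDerivAt.comp u (g := g) hgd.hasFDerivAt hL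
  have := ((hP u).hasFDerivAt.add hc).fderiv
  unfold pd
  rw [dd_eq]
  erw [this]
  simp

/-- a family of polynomials closed under partial derivatives -/
def qq (a b c d e g h k l m : ℝ) (u : Fin 3 → ℝ) : ℝ :=
  a * u 0 ^ 2 * u 2 + b * u 0 * u 1 ^ 2 + c * u 0 * u 2 + d * u 1 ^ 2 + e * u 0 * u 1
    + g * u 0 ^ 2 + h * u 0 + k * u 1 + l * u 2 + m

lemma qq_diff (a b c d e g h k l m : ℝ) : Differentiable ℝ (qq a b c d e g h k l m) := by
  unfold qq; fun_prop

lemma pd_qq (a b c d e g h k l m : ℝ) (j : Fin 3) (u : Fin 3 → ℝ) :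
    pd (qq a b c d e g h k l m) j u =
      ![qq 0 0 (2 * a) b 0 0 (2 * g) e c h u, qq 0 0 0 0 (2 * b) 0 e (2 * d) 0 k u,
        qq 0 0 0 0 0 a c 0 0 l u] j := by
  have h0 : ∀ i : Fin 3, HasFDerivAt (fun u : Fin 3 → ℝ => u i)
    (ContinuousLinearMap.proj (R := ℝ) (φ := fun _ : Fin 3 => ℝ) i) u := fun i =>
      (ContinuousLinearMap.proj (R := ℝ) (φ := fun _ : Fin 3 => ℝ) i).hasFDerivAt
  have H := ((((((((((((h0 0).pow 2).const_mul a).mul (h0 2)).add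
    (((h0 0).const_mul b).mul ((h0 1).pow 2))).add (((h0 0).const_mul c).mul (h0 2))).add
    (((h0 1).pow 2).const_mul d)).add (((h0 0).const_mul e).mul (h0 1))).add
    (((h0 0).pow 2).const_mul g)).add ((h0 0).const_mul h)).add ((h0 1).const_mul k)).add
    ((h0 2).const_mul l)).add_const m
  have H' := H.fderiv
  have e1 : pd (qq a b c d e g h k l m) j u = _ := congrArg (fun L => L (Pi.single j 1)) H'
  rw [e1]
  fin_cases j <;> simp [qq] <;> ring

/-- explicit first derivatives of the cubic part -/
lemma d3_form {W : Set (ℝ × ℝ)} (hW : IsOpen W) {f : ℝ × ℝ → ℝ}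
    (hf : ContDiffOn ℝ (⊤ : ℕ∞) f W) (i j k : Fin 3) (u : Fin 3 → ℝ) (hu : (u 1, u 2) ∈ W) :
    d3 (fun u => qq (1/2) (1/2) 0 0 0 0 0 0 0 0 u + f (u 1, u 2)) i j k u =
      d3 (qq (1/2) (1/2) 0 0 0 0 0 0 0 0) i j k u + dd i (dd j (dd k f)) (u 1, u 2) := by
  have hU : IsOpen {u : Fin 3 → ℝ | (u 1, u 2) ∈ W} := hW.preimage (by fun_prop)
  have s1 := dd_smooth hW hf k
  have s2 := dd_smooth hW s1 j
  have dP : ∀ a b c d e g h k l m (j : Fin 3),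
      ∃ a' b' c' d' e' g' h' k' l' m', (fun u => pd (qq a b c d e g h k l m) j u)
        = qq a' b' c' d' e' g' h' k' l' m' := by
    intro a b c d e g h k l m j
    have := fun u => pd_qq a b c d e g h k l m j u
    fin_cases j
    all_goals exact ⟨_, _, _, _, _, _, _, _, _, _, funext this⟩
  have hP := qq_diff (1/2) (1/2) 0 0 0 0 0 0 0 0
  obtain ⟨a, b, c, d, e, g, h, q, l, m, E1⟩ := dP (1/2) (1/2) 0 0 0 0 0 0 0 0 k
  obtain ⟨a', b', c', d', e', g', h', q', l', m', E2⟩ := dP a b c d e g h q l m j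
  have A1 : ∀ v : Fin 3 → ℝ, (v 1, v 2) ∈ W →
      pd (fun w => pd (fun u => qq (1/2) (1/2) 0 0 0 0 0 0 0 0 u + f (u 1, u 2)) k w) j v =
      qq a' b' c' d' e' g' h' q' l' m' v + dd j (dd k f) (v 1, v 2) := by
    intro v hv
    rw [pd_congr' (G := fun u => qq a b c d e g h q l m u + dd k f (u 1, u 2)),
      pd_add_comp hW s1 (qq_diff _ _ _ _ _ _ _ _ _ _) j v hv, congrFun E2 v]
    refine Filter.eventuallyEq_of_mem (hU.mem_nhds hv) fun w hw => ?_
    rw [pd_add_comp hW hf hP k w hw, congrFun E1 w]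
  unfold d3
  rw [E1, E2, pd_congr' (G := fun u => qq a' b' c' d' e' g' h' q' l' m' u +
      dd j (dd k f) (u 1, u 2)), pd_add_comp hW s2 (qq_diff _ _ _ _ _ _ _ _ _ _) i u hu]
  exact Filter.eventuallyEq_of_mem (hU.mem_nhds hu) A1

/-- third derivatives of the cubic part -/
lemma d3_qq (i j k : Fin 3) (u : Fin 3 → ℝ) :
    d3 (qq (1/2) (1/2) 0 0 0 0 0 0 0 0) i j k u =
      ![!![0, 0, 1; 0, 1, 0; 1, 0, 0], !![0, 1, 0; 1, 0, 0; 0, 0, 0],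
        !![1, 0, 0; 0, 0, 0; 0, 0, 0]] i j k := by
  unfold d3
  have E : ∀ a b c d e g h k l m (j : Fin 3), pd (qq a b c d e g h k l m) j =
      ![qq 0 0 (2 * a) b 0 0 (2 * g) e c h, qq 0 0 0 0 (2 * b) 0 e (2 * d) 0 k,
        qq 0 0 0 0 0 a c 0 0 l] j := by
    intros; funext u; rw [pd_qq]; rename_i j; fin_cases j <;> rfl
  change pd (pd (pd _ k) j) i u = _
  fin_cases k <;> fin_cases j <;> fin_cases i <;> simp [E] <;> simp [qq]

/-- For the potential `Φ = ½(u¹)²u³ + ½u¹(u²)² + f(u², u³)` and the antidiagonal metric `η`,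
the WDVV associativity equations on `ℝ × W` are equivalent to the Dubrovin equation
`f_{333} = (f_{223})² − f_{222} f_{233}` on `W`. -/
theorem wdvv_iff_dubrovin_equation
    (W : Set (ℝ × ℝ)) (hW : IsOpen W)
    (f : ℝ × ℝ → ℝ) (hf : ContDiffOn ℝ (⊤ : ℕ∞) f W)
    (Φ : (Fin 3 → ℝ) → ℝ)
    (hΦ : Φ = fun u => (1 / 2) * (u 0) ^ 2 * u 2 + (1 / 2) * u 0 * (u 1) ^ 2 + f (u 1, u 2))
    (η : Matrix (Fin 3) (Fin 3) ℝ) (hη : η = !![0, 0, 1; 0, 1, 0; 1, 0, 0]) :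
    (∀ u : Fin 3 → ℝ, (u 1, u 2) ∈ W → ∀ i j m n : Fin 3,
        ∑ k, ∑ l, d3 Φ i j k u * η k l * d3 Φ l m n u =
          ∑ k, ∑ l, d3 Φ i m k u * η k l * d3 Φ l j n u) ↔
      (∀ p ∈ W, pdt (pdt (pdt f)) p =
        (pdx (pdx (pdt f)) p) ^ 2 - pdx (pdx (pdx f)) p * pdx (pdt (pdt f)) p) := by
  classical
  have hΦ' : Φ = fun u => qq (1/2) (1/2) 0 0 0 0 0 0 0 0 u + f (u 1, u 2) := by
    rw [hΦ]; funext u; simp only [qq]; ring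
  have D : ∀ u : Fin 3 → ℝ, (u 1, u 2) ∈ W → ∀ i j k, d3 Φ i j k u =
      ![!![0, 0, 1; 0, 1, 0; 1, 0, 0], !![0, 1, 0; 1, 0, 0; 0, 0, 0],
        !![1, 0, 0; 0, 0, 0; 0, 0, 0]] i j k + dd i (dd j (dd k f)) (u 1, u 2) := by
    intro u hu i j k
    rw [hΦ', d3_form hW hf i j k u hu, d3_qq]
  have hz : ∀ p ∈ W, ∀ i j, dd 0 (dd i (dd j f)) p = 0 ∧ dd i (dd 0 (dd j f)) p = 0
      ∧ dd i (dd j (dd 0 f)) p = 0 := by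
    intro p hp i j
    refine ⟨rfl, ?_, ?_⟩
    · rw [dd_comm hW (dd_smooth hW hf j) i 0 p hp]; rfl
    · rw [dd_congr hW (dd_comm hW hf j 0) i p hp,
        dd_comm hW (dd_smooth hW hf j) i 0 p hp]; rfl
  have hs : ∀ p ∈ W, dd 1 (dd 2 (dd 1 f)) p = dd 1 (dd 1 (dd 2 f)) p
      ∧ dd 2 (dd 1 (dd 1 f)) p = dd 1 (dd 1 (dd 2 f)) p
      ∧ dd 2 (dd 1 (dd 2 f)) p = dd 1 (dd 2 (dd 2 f)) p
      ∧ dd 2 (dd 2 (dd 1 f)) p = dd 1 (dd 2 (dd 2 f)) p := by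
    intro p hp
    have a1 := dd_congr hW (dd_comm hW hf 2 1) 1 p hp
    have a2 := dd_comm hW (dd_smooth hW hf 1) 2 1 p hp
    have a3 := dd_comm hW (dd_smooth hW hf 2) 2 1 p hp
    have a4 := dd_congr hW (dd_comm hW hf 2 1) 2 p hp
    exact ⟨a1, a2.trans a1, a3, a4.trans a3⟩
  change _ ↔ (∀ p ∈ W, dd 2 (dd 2 (dd 2 f)) p =
        (dd 1 (dd 1 (dd 2 f)) p) ^ 2 - dd 1 (dd 1 (dd 1 f)) p * dd 1 (dd 2 (dd 2 f)) p)
  subst hη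
  constructor
  · intro H p hp
    have h := H ![0, p.1, p.2] hp 1 1 2 2
    have D' := D ![0, p.1, p.2] hp
    obtain ⟨b1, b2, b3, b4⟩ := hs p hp
    have z := hz p hp
    have z1 := fun i j => (z i j).1
    have z2 := fun i j => (z i j).2.1
    have z3 := fun i j => (z i j).2.2
    simp [D', Fin.sum_univ_three, z1, z2, z3, b1, b2, b3, b4] at h
    linarith
  · intro H u hu
    have h := H _ hu
    have D' := D u hu
    obtain ⟨b1, b2, b3, b4⟩ := hs _ hu
    have z := hz _ hu
    have z1 := fun i j => (z i j).1
    have z2 := fun i j => (z i j).2.1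
    have z3 := fun i j => (z i j).2.2
    intro i j m n
    fin_cases i <;> fin_cases j <;> fin_cases m <;> fin_cases n <;>
      simp [D', Fin.sum_univ_three, z1, z2, z3, b1, b2, b3, b4, h] <;> ring
end

section
/- Let W ⊆ ℝ² be open with coordinates (x, t) and let f : W → ℝ be smooth. Define a¹ = f_{xxx}, a² = f_{xxt}, a³ = f_{xtt} (third partial derivatives of f). If f satisfies f_{ttt} = (f_{xxt})² − f_{xxx} f_{xtt} on W, then (a¹, a², a³) satisfies the quasilinear system of hydrodynamic type a¹_t = a²_x, a²_t = a³_x, a³_t = −a³ a¹_x + 2 a² a²_x − a¹ a³_x on W. -/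
theorem pd_congr {W : Set (ℝ × ℝ)} (hW : IsOpen W) {g h : ℝ × ℝ → ℝ}
    (e : ∀ p ∈ W, g p = h p) {p : ℝ × ℝ} (hp : p ∈ W) : fderiv ℝ g p = fderiv ℝ h p := by
  apply Filter.EventuallyEq.fderiv_eq
  filter_upwards [hW.mem_nhds hp] with q hq using e q hq

theorem pd_smooth {W : Set (ℝ × ℝ)} (hW : IsOpen W) {g : ℝ × ℝ → ℝ}
    (hg : ContDiffOn ℝ (⊤ : ℕ∞) g W) (v : ℝ × ℝ) :
    ContDiffOn ℝ (⊤ : ℕ∞) (fun p => fderiv ℝ g p v) W :=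
  (hg.fderiv_of_isOpen hW (m := (⊤ : ℕ∞)) (by simp)).clm_apply contDiffOn_const

theorem pd_swap {W : Set (ℝ × ℝ)} (hW : IsOpen W) {g : ℝ × ℝ → ℝ}
    (hg : ContDiffOn ℝ (⊤ : ℕ∞) g W) : ∀ p ∈ W, pdt (pdx g) p = pdx (pdt g) p := by
  intro p hp
  have hd : DifferentiableAt ℝ (fderiv ℝ g) p :=
    ((hg.fderiv_of_isOpen hW (m := (⊤ : ℕ∞)) (by simp)).differentiableOn
      (by simp)).differentiableAt (hW.mem_nhds hp)
  have hs : IsSymmSndFDerivAt ℝ g p :=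
    (hg.contDiffAt (hW.mem_nhds hp)).isSymmSndFDerivAt (by
      simp only [minSmoothness_of_isRCLikeNormedField]
      exact WithTop.coe_le_coe.2 (le_top : (2 : ℕ∞) ≤ ⊤))
  have key : ∀ v w : ℝ × ℝ, fderiv ℝ (fun q => fderiv ℝ g q v) p w
      = fderiv ℝ (fderiv ℝ g) p w v := by
    intro v w
    rw [fderiv_clm_apply hd (differentiableAt_const v)]
    simp
  exact (key (1, 0) (0, 1)).trans ((hs (0, 1) (1, 0)).trans (key (0, 1) (1, 0)).symm)

/-- If `f` satisfies the Dubrovin equation `f_{ttt} = (f_{xxt})² − f_{xxx} f_{xtt}` on `W`, then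
`a¹ = f_{xxx}`, `a² = f_{xxt}`, `a³ = f_{xtt}` satisfy the hydrodynamic-type system
`a¹_t = a²_x`, `a²_t = a³_x`, `a³_t = −a³ a¹_x + 2a² a²_x − a¹ a³_x` on `W`. -/
theorem dubrovin_equation_gives_hydrodynamic_system
    (W : Set (ℝ × ℝ)) (hW : IsOpen W)
    (f : ℝ × ℝ → ℝ) (hf : ContDiffOn ℝ (⊤ : ℕ∞) f W)
    (a1 a2 a3 : ℝ × ℝ → ℝ)
    (ha1 : a1 = pdx (pdx (pdx f))) (ha2 : a2 = pdx (pdx (pdt f)))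
    (ha3 : a3 = pdx (pdt (pdt f)))
    (heq : ∀ p ∈ W, pdt (pdt (pdt f)) p = (a2 p) ^ 2 - a1 p * a3 p) :
    ∀ p ∈ W,
      pdt a1 p = pdx a2 p ∧
      pdt a2 p = pdx a3 p ∧
      pdt a3 p = -a3 p * pdx a1 p + 2 * a2 p * pdx a2 p - a1 p * pdx a3 p := by
  have sx : ∀ {g : ℝ × ℝ → ℝ}, ContDiffOn ℝ (⊤ : ℕ∞) g W → ContDiffOn ℝ (⊤ : ℕ∞) (pdx g) W :=
    fun hg => pd_smooth hW hg (1, 0)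
  have st : ∀ {g : ℝ × ℝ → ℝ}, ContDiffOn ℝ (⊤ : ℕ∞) g W → ContDiffOn ℝ (⊤ : ℕ∞) (pdt g) W :=
    fun hg => pd_smooth hW hg (0, 1)
  have cx : ∀ {g h : ℝ × ℝ → ℝ}, (∀ p ∈ W, g p = h p) → ∀ p ∈ W, pdx g p = pdx h p :=
    fun e p hp => congrArg (fun L => L (1, 0)) (pd_congr hW e hp)
  have sw2 : ∀ {g : ℝ × ℝ → ℝ}, ContDiffOn ℝ (⊤ : ℕ∞) g W →
      ∀ p ∈ W, pdt (pdx (pdx g)) p = pdx (pdx (pdt g)) p := fun hg p hp =>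
    (pd_swap hW (sx hg) p hp).trans (cx (pd_swap hW hg) p hp)
  intro p hp
  have d : ∀ {g : ℝ × ℝ → ℝ}, ContDiffOn ℝ (⊤ : ℕ∞) g W → DifferentiableAt ℝ g p := fun hg =>
    (hg.differentiableOn (by simp)).differentiableAt (hW.mem_nhds hp)
  have d1 : DifferentiableAt ℝ a1 p := ha1 ▸ d (sx (sx (sx hf)))
  have d2 : DifferentiableAt ℝ a2 p := ha2 ▸ d (sx (sx (st hf)))
  have d3 : DifferentiableAt ℝ a3 p := ha3 ▸ d (sx (st (st hf)))
  refine ⟨?_, ?_, ?_⟩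
  · rw [ha1, ha2]
    exact (pd_swap hW (sx (sx hf)) p hp).trans (cx (sw2 hf) p hp)
  · rw [ha2, ha3]
    exact sw2 (st hf) p hp
  · have h1 : pdt a3 p = pdx (fun q => a2 q ^ 2 - a1 q * a3 q) p := by
      rw [ha3, pd_swap hW (st (st hf)) p hp, ← ha3]
      exact cx heq p hp
    have h2 := ((d2.hasFDerivAt.pow 2).sub (d1.hasFDerivAt.mul d3.hasFDerivAt)).fderiv
    have h3 : pdx (fun q => a2 q ^ 2 - a1 q * a3 q) p = _ := congrArg (fun L => L (1, 0)) h2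
    rw [h1, h3]
    simp [pdx]
    ring
end

section
/- Let G : ℝ³ → Matrix (Fin 3) (Fin 3) ℝ be given by G(a) = [[−3/2, a¹/2, a²], [a¹/2, a², 3a³/2], [a², 3a³/2, 2((a²)² − a¹a³)]], and let U = { a ∈ ℝ³ : det G(a) ≠ 0 }. Then on U the contravariant metric G is flat: its curvature tensor R^i_{jkl} vanishes identically on U. -/
/-- Christoffel symbols `Γ^i_{jk}` of the Levi-Civita connection of a contravariant metric `g`
(the covariant metric `g_{ij}` being the matrix inverse of `g`). -/
noncomputable def christoffel {N : ℕ} (g : (Fin N → ℝ) → Matrix (Fin N) (Fin N) ℝ)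
    (i j k : Fin N) (u : Fin N → ℝ) : ℝ :=
  (1 / 2) * ∑ s, g u i s *
    (pd (fun v => (g v)⁻¹ s k) j u + pd (fun v => (g v)⁻¹ j s) k u -
      pd (fun v => (g v)⁻¹ j k) s u)

/-- Riemannian curvature tensor `R^i_{jkl}` of a contravariant metric `g`. -/
noncomputable def curvature {N : ℕ} (g : (Fin N → ℝ) → Matrix (Fin N) (Fin N) ℝ)
    (i j k l : Fin N) (u : Fin N → ℝ) : ℝ :=
  pd (christoffel g i j l) k u - pd (christoffel g i j k) l u +
    ∑ p, (christoffel g i p k u * christoffel g p j l u -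
          christoffel g i p l u * christoffel g p j k u)

noncomputable def wD (v : Fin 3 → ℝ) : ℝ :=
  (27/8) * v 2^2 + (-4) * v 1^3 + (9/2) * v 0 * v 1 * v 2 + (-1/2) * v 0^2 * v 1^2 + (1/2) * v 0^3 * v 2

noncomputable def wA (i j : Fin 3) (v : Fin 3 → ℝ) : ℝ :=
  (![![(-9/4) * v 2^2 + (2) * v 1^3 + (-2) * v 0 * v 1 * v 2, (3/2) * v 1 * v 2 + (-1) * v 0 * v 1^2 + (1) * v 0^2 * v 2, (-1) * v 1^2 + (3/4) * v 0 * v 2],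
    ![(3/2) * v 1 * v 2 + (-1) * v 0 * v 1^2 + (1) * v 0^2 * v 2, (-4) * v 1^2 + (3) * v 0 * v 2, (9/4) * v 2 + (1/2) * v 0 * v 1],
    ![(-1) * v 1^2 + (3/4) * v 0 * v 2, (9/4) * v 2 + (1/2) * v 0 * v 1, (-3/2) * v 1 + (-1/4) * v 0^2]] :
    Fin 3 → Fin 3 → ℝ) i j

noncomputable def wN2 (i j : Fin 3) (v : Fin 3 → ℝ) : ℝ :=
  (![![(-1) * v 1^2 * v 2 + (3/4) * v 0 * v 2^2, (9/4) * v 2^2 + (1/2) * v 0 * v 1 * v 2, (-3/2) * v 1 * v 2 + (-1/4) * v 0^2 * v 2],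
    ![(9/4) * v 2^2 + (1/2) * v 0 * v 1 * v 2, (-6) * v 1 * v 2 + (-1) * v 0^2 * v 2, (4) * v 1^2 + (-3/4) * v 0 * v 2 + (1/2) * v 0^2 * v 1],
    ![(-3/2) * v 1 * v 2 + (-1/4) * v 0^2 * v 2, (4) * v 1^2 + (-3/4) * v 0 * v 2 + (1/2) * v 0^2 * v 1, (-9/4) * v 2 + (-2) * v 0 * v 1 + (-1/4) * v 0^3]] :
    Fin 3 → Fin 3 → ℝ) i j

noncomputable def wN (i j k : Fin 3) (v : Fin 3 → ℝ) : ℝ :=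
  (![0, -(1 / 2) * wA j k v, wN2 j k v] : Fin 3 → ℝ) i

noncomputable def wdD (k : Fin 3) (v : Fin 3 → ℝ) : ℝ :=
  (![(9/2) * v 1 * v 2 + (-1) * v 0 * v 1^2 + (3/2) * v 0^2 * v 2, (-12) * v 1^2 + (9/2) * v 0 * v 2 + (-1) * v 0^2 * v 1, (27/4) * v 2 + (9/2) * v 0 * v 1 + (1/2) * v 0^3] : Fin 3 → ℝ) k

noncomputable def wdA (i j k : Fin 3) (v : Fin 3 → ℝ) : ℝ :=
  (![![![(-2) * v 1 * v 2, (-1) * v 1^2 + (2) * v 0 * v 2, (3/4) * v 2],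
    ![(-1) * v 1^2 + (2) * v 0 * v 2, (3) * v 2, (1/2) * v 1],
    ![(3/4) * v 2, (1/2) * v 1, (-1/2) * v 0]],
    ![![(6) * v 1^2 + (-2) * v 0 * v 2, (3/2) * v 2 + (-2) * v 0 * v 1, (-2) * v 1],
    ![(3/2) * v 2 + (-2) * v 0 * v 1, (-8) * v 1, (1/2) * v 0],
    ![(-2) * v 1, (1/2) * v 0, (-3/2)]],
    ![![(-9/2) * v 2 + (-2) * v 0 * v 1, (3/2) * v 1 + (1) * v 0^2, (3/4) * v 0],
    ![(3/2) * v 1 + (1) * v 0^2, (3) * v 0, (9/4)],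
    ![(3/4) * v 0, (9/4), 0]]] : Fin 3 → Fin 3 → Fin 3 → ℝ) k i j

noncomputable def wdN2 (i j k : Fin 3) (v : Fin 3 → ℝ) : ℝ :=
  (![![![(3/4) * v 2^2, (1/2) * v 1 * v 2, (-1/2) * v 0 * v 2],
    ![(1/2) * v 1 * v 2, (-2) * v 0 * v 2, (-3/4) * v 2 + (1) * v 0 * v 1],
    ![(-1/2) * v 0 * v 2, (-3/4) * v 2 + (1) * v 0 * v 1, (-2) * v 1 + (-3/4) * v 0^2]],
    ![![(-2) * v 1 * v 2, (1/2) * v 0 * v 2, (-3/2) * v 2],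
    ![(1/2) * v 0 * v 2, (-6) * v 2, (8) * v 1 + (1/2) * v 0^2],
    ![(-3/2) * v 2, (8) * v 1 + (1/2) * v 0^2, (-2) * v 0]],
    ![![(-1) * v 1^2 + (3/2) * v 0 * v 2, (9/2) * v 2 + (1/2) * v 0 * v 1, (-3/2) * v 1 + (-1/4) * v 0^2],
    ![(9/2) * v 2 + (1/2) * v 0 * v 1, (-6) * v 1 + (-1) * v 0^2, (-3/4) * v 0],
    ![(-3/2) * v 1 + (-1/4) * v 0^2, (-3/4) * v 0, (-9/4)]]] : Fin 3 → Fin 3 → Fin 3 → ℝ) k i j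

noncomputable def wdN (i j k l : Fin 3) (v : Fin 3 → ℝ) : ℝ :=
  (![0, -(1 / 2) * wdA j k l v, wdN2 j k l v] : Fin 3 → ℝ) i

/-- `f` is differentiable with gradient `d`. -/
def HG (f : (Fin 3 → ℝ) → ℝ) (d : Fin 3 → (Fin 3 → ℝ) → ℝ) : Prop :=
  ∀ u, DifferentiableAt ℝ f u ∧ ∀ k, pd f k u = d k u

theorem pd_coord (i k : Fin 3) (u : Fin 3 → ℝ) :
    pd (fun v => v i) k u = if i = k then 1 else 0 := by
  unfold pd
  rw [(hasFDerivAt_apply i u).fderiv]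
  simp [Pi.single_apply]

theorem HG_coord (i : Fin 3) : HG (fun v => v i) (fun k _ => if i = k then 1 else 0) :=
  fun u => ⟨by fun_prop, fun k => pd_coord i k u⟩

theorem HG_const (c : ℝ) : HG (fun _ => c) (fun _ _ => 0) :=
  fun u => ⟨by fun_prop, fun k => by simp [pd]⟩

theorem HG_add {f g : (Fin 3 → ℝ) → ℝ} {d e : Fin 3 → (Fin 3 → ℝ) → ℝ} (hf : HG f d) (hg : HG g e) :
    HG (fun v => f v + g v) (fun k v => d k v + e k v) := fun u =>
  ⟨(hf u).1.add (hg u).1, fun k => by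
    beta_reduce; rw [← (hf u).2, ← (hg u).2]; unfold pd; rw [fderiv_fun_add (hf u).1 (hg u).1]; rfl⟩

theorem HG_mul {f g : (Fin 3 → ℝ) → ℝ} {d e : Fin 3 → (Fin 3 → ℝ) → ℝ} (hf : HG f d) (hg : HG g e) :
    HG (fun v => f v * g v) (fun k v => f v * e k v + g v * d k v) := fun u =>
  ⟨(hf u).1.mul (hg u).1, fun k => by
    beta_reduce; rw [← (hf u).2, ← (hg u).2]; unfold pd; rw [fderiv_fun_mul (hf u).1 (hg u).1]; simp⟩

theorem HG_pow {f : (Fin 3 → ℝ) → ℝ} {d : Fin 3 → (Fin 3 → ℝ) → ℝ} (hf : HG f d) (n : ℕ) :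
    HG (fun v => f v ^ n) (fun k v => n * f v ^ (n - 1) * d k v) := fun u =>
  ⟨(hf u).1.pow n, fun k => by
    beta_reduce; rw [← (hf u).2]; unfold pd; rw [fderiv_fun_pow n (hf u).1]; simp⟩

theorem HG_congr {f : (Fin 3 → ℝ) → ℝ} {d e : Fin 3 → (Fin 3 → ℝ) → ℝ} (hf : HG f d)
    (h : ∀ v k, d k v = e k v) : HG f e := fun u =>
  ⟨(hf u).1, fun k => by rw [(hf u).2, h]⟩

theorem HG_D : HG wD wdD := by
  unfold wD
  refine HG_congr (by repeat' first | exact HG_coord _ | exact HG_const _ | with_reducible apply HG_pow | with_reducible apply HG_add | with_reducible apply HG_mul) ?_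
  intro v k
  fin_cases k <;> simp [wdD] <;> ring

theorem HG_A (i j : Fin 3) : HG (wA i j) (wdA i j) := by
  unfold wA
  fin_cases i <;> fin_cases j <;> simp only [Fin.zero_eta, Fin.mk_one, Fin.reduceFinMk, Matrix.cons_val] <;>
  refine HG_congr (by repeat' first | exact HG_coord _ | exact HG_const _ | with_reducible apply HG_pow | with_reducible apply HG_add | with_reducible apply HG_mul) ?_ <;>
  intro v k <;>
  fin_cases k <;> simp [wdA] <;> try ring

theorem HG_N2 (i j : Fin 3) : HG (wN2 i j) (wdN2 i j) := by
  unfold wN2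
  fin_cases i <;> fin_cases j <;> simp only [Fin.zero_eta, Fin.mk_one, Fin.reduceFinMk, Matrix.cons_val] <;>
  refine HG_congr (by repeat' first | exact HG_coord _ | exact HG_const _ | with_reducible apply HG_pow | with_reducible apply HG_add | with_reducible apply HG_mul) ?_ <;>
  intro v k <;>
  fin_cases k <;> simp [wdN2] <;> try ring

theorem HG_N (i j k : Fin 3) : HG (wN i j k) (wdN i j k) := by
  fin_cases i
  · exact HG_const 0
  · exact HG_congr (HG_mul (HG_const _) (HG_A j k)) (fun v l => by simp [wdN])
  · exact HG_N2 j k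

theorem pd_div {f g : (Fin 3 → ℝ) → ℝ} {d e : Fin 3 → (Fin 3 → ℝ) → ℝ} (hf : HG f d) (hg : HG g e)
    (u : Fin 3 → ℝ) (h : g u ≠ 0) (k : Fin 3) :
    pd (fun v => f v / g v) k u = (d k u * g u - f u * e k u) / g u ^ 2 := by
  rw [← (hf u).2, ← (hg u).2]
  unfold pd
  have h1 : HasFDerivAt (fun v => (g v)⁻¹) (-(g u ^ 2)⁻¹ • fderiv ℝ g u) u :=
    (hasDerivAt_inv h).comp_hasFDerivAt u (hg u).1.hasFDerivAt
  simp only [div_eq_mul_inv]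
  rw [fderiv_fun_mul (hf u).1 h1.differentiableAt, h1.fderiv]
  simp
  field_simp
  ring

noncomputable def wG (a : Fin 3 → ℝ) : Matrix (Fin 3) (Fin 3) ℝ :=
  !![-(3 / 2), a 0 / 2, a 1;
     a 0 / 2, a 1, 3 * a 2 / 2;
     a 1, 3 * a 2 / 2, 2 * ((a 1) ^ 2 - a 0 * a 2)]

theorem wG_det (v : Fin 3 → ℝ) : (wG v).det = wD v := by
  simp [wG, wD, Matrix.det_fin_three]
  ring

theorem wG_inv (i j : Fin 3) (v : Fin 3 → ℝ) : (wG v)⁻¹ i j = wA i j v / wD v := by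
  rw [Matrix.inv_def, wG_det, Matrix.smul_apply, Ring.inverse_eq_inv', smul_eq_mul, div_eq_inv_mul]
  congr 1
  rw [wG, Matrix.adjugate_fin_three_of]
  fin_cases i <;> fin_cases j <;> simp [wA] <;> ring

theorem wG_chr_aux (i j k : Fin 3) (v : Fin 3 → ℝ) :
    (1 / 2) * ∑ s, wG v i s * ((wdA s k j v * wD v - wA s k v * wdD j v)
      + (wdA j s k v * wD v - wA j s v * wdD k v) - (wdA j k s v * wD v - wA j k v * wdD s v))
      = wN i j k v * wD v := by
  rw [Fin.sum_univ_three]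
  fin_cases i <;> fin_cases j <;> fin_cases k <;>
  simp only [wG, wA, wdA, wN, wN2, wD, wdD, Fin.zero_eta, Fin.mk_one, Fin.reduceFinMk,
    Matrix.cons_val, Matrix.of_apply] <;> ring

theorem wG_chr (i j k : Fin 3) (v : Fin 3 → ℝ) (h : wD v ≠ 0) :
    christoffel wG i j k v = wN i j k v / wD v := by
  unfold christoffel
  simp only [wG_inv, pd_div (HG_A _ _) HG_D v h]
  have := wG_chr_aux i j k v
  rw [eq_div_iff h, ← mul_left_inj' h, ← this, Fin.sum_univ_three, Fin.sum_univ_three]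
  field_simp

theorem wG_curv_aux (i j k l : Fin 3) (v : Fin 3 → ℝ) :
    (wdN i j l k v * wD v - wN i j l v * wdD k v) - (wdN i j k l v * wD v - wN i j k v * wdD l v)
     + (wN i 0 k v * wN 0 j l v - wN i 0 l v * wN 0 j k v
      + (wN i 1 k v * wN 1 j l v - wN i 1 l v * wN 1 j k v)
      + (wN i 2 k v * wN 2 j l v - wN i 2 l v * wN 2 j k v)) = 0 := by
  fin_cases i <;> fin_cases j <;> fin_cases k <;> fin_cases l <;>
  simp only [wA, wdA, wN, wdN, wN2, wdN2, wD, wdD, Fin.zero_eta, Fin.mk_one, Fin.reduceFinMk,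
    Matrix.cons_val] <;> ring

theorem wG_curv (i j k l : Fin 3) (a : Fin 3 → ℝ) (h : wD a ≠ 0) : curvature wG i j k l a = 0 := by
  have hev : ∀ i j k, christoffel wG i j k =ᶠ[nhds a] fun v => wN i j k v / wD v := by
    intro i j k
    filter_upwards [(HG_D a).1.continuousAt.eventually_ne h] with v hv using wG_chr i j k v hv
  have hpd : ∀ i j k l, pd (christoffel wG i j k) l a
      = (wdN i j k l a * wD a - wN i j k a * wdD l a) / wD a ^ 2 := by
    intro i j k l
    rw [← pd_div (HG_N i j k) HG_D a h l]
    unfold pd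
    rw [(hev i j k).fderiv_eq]
  unfold curvature
  simp only [hpd, wG_chr _ _ _ a h, Fin.sum_univ_three]
  have := wG_curv_aux i j k l a
  rw [← zero_div (wD a ^ 2), ← this]
  field_simp

/-- The contravariant metric of the first (local Dubrovin–Novikov) Hamiltonian structure of the
WDVV hydrodynamic-type system is flat on the open set where it is non-degenerate. -/
theorem first_hamiltonian_metric_of_wdvv_is_flat
    (G : (Fin 3 → ℝ) → Matrix (Fin 3) (Fin 3) ℝ)
    (hG : G = fun a => !![-(3 / 2), a 0 / 2, a 1;
                          a 0 / 2, a 1, 3 * a 2 / 2;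
                          a 1, 3 * a 2 / 2, 2 * ((a 1) ^ 2 - a 0 * a 2)]) :
    ∀ a : Fin 3 → ℝ, (G a).det ≠ 0 → ∀ i j k l : Fin 3, curvature G i j k l a = 0 := by
  have hw : G = wG := hG
  subst hw
  intro a h i j k l
  rw [wG_det] at h
  exact wG_curv i j k l a h
end

section
/- Let G : ℝ³ → Matrix (Fin 3) (Fin 3) ℝ be given by G(a) = [[0, 0, 1], [0, 1, −a¹], [1, −a¹, (a¹)² + 2a²]]. Then G(a) is symmetric and invertible for every a ∈ ℝ³ (det G(a) = −1), and the contravariant metric G is flat: its curvature tensor R^i_{jkl} vanishes identically on ℝ³. -/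
lemma pd_aux (f : (Fin 3 → ℝ) → ℝ) (c p q : ℝ) (hf : ∀ v, f v = c + p * v 0 + q * v 1)
    (j : Fin 3) (u : Fin 3 → ℝ) : pd f j u = ![p, q, 0] j := by
  have h0 : HasFDerivAt (fun v : Fin 3 → ℝ => v 0) (ContinuousLinearMap.proj (R := ℝ) (φ := fun _ : Fin 3 => ℝ) 0) u :=
    hasFDerivAt_apply 0 u
  have h1 : HasFDerivAt (fun v : Fin 3 → ℝ => v 1) (ContinuousLinearMap.proj (R := ℝ) (φ := fun _ : Fin 3 => ℝ) 1) u :=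
    hasFDerivAt_apply 1 u
  have h := ((h0.const_mul p).const_add c).add (h1.const_mul q)
  have e : f = (fun v => c + p * v 0) + (fun v => q * v 1) := by
    funext v; simp [hf]
  unfold pd
  rw [e, h.fderiv]
  fin_cases j <;> simp

/-- The WDVV metric. -/
def gw (a : Fin 3 → ℝ) : Matrix (Fin 3) (Fin 3) ℝ :=
  !![0, 0, 1; 0, 1, -a 0; 1, -a 0, (a 0) ^ 2 + 2 * a 1]

lemma gw_inv (a : Fin 3 → ℝ) : (gw a)⁻¹ = !![-2 * a 1, a 0, 1; a 0, 1, 0; 1, 0, 0] := by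
  apply Matrix.inv_eq_right_inv
  ext i j
  fin_cases i <;> fin_cases j <;> simp [gw, Matrix.mul_apply, Fin.sum_univ_three] <;> ring

lemma pd_inv (s k j : Fin 3) (u : Fin 3 → ℝ) : pd (fun v => (gw v)⁻¹ s k) j u =
    if j = 0 then (if s = 0 ∧ k = 1 ∨ s = 1 ∧ k = 0 then 1 else 0) else
      if j = 1 ∧ s = 0 ∧ k = 0 then -2 else 0 := by
  have key := pd_aux (fun v => (gw v)⁻¹ s k)
    ((!![0, 0, 1; 0, 1, 0; 1, 0, 0] : Matrix (Fin 3) (Fin 3) ℝ) s k)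
    (if s = 0 ∧ k = 1 ∨ s = 1 ∧ k = 0 then 1 else 0)
    (if s = 0 ∧ k = 0 then -2 else 0)
    (by intro v; rw [gw_inv]; fin_cases s <;> fin_cases k <;> simp) j u
  rw [key]
  fin_cases j <;> simp

lemma chr (i j k : Fin 3) (u : Fin 3 → ℝ) : christoffel gw i j k u =
    if i = 1 ∧ j = 0 ∧ k = 0 then 2 else if i = 2 ∧ j = 0 ∧ k = 0 then -2 * u 0 else
      if i = 2 ∧ (j = 0 ∧ k = 1 ∨ j = 1 ∧ k = 0) then -1 else 0 := by
  unfold christoffel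
  simp only [pd_inv, Fin.sum_univ_three]
  fin_cases i <;> fin_cases j <;> fin_cases k <;> simp [gw] <;> ring_nf

lemma pd_chr (i j k l : Fin 3) (u : Fin 3 → ℝ) : pd (christoffel gw i j k) l u =
    if i = 2 ∧ j = 0 ∧ k = 0 ∧ l = 0 then -2 else 0 := by
  have key := pd_aux (christoffel gw i j k)
    (if i = 1 ∧ j = 0 ∧ k = 0 then 2 else
      if i = 2 ∧ (j = 0 ∧ k = 1 ∨ j = 1 ∧ k = 0) then -1 else 0)
    (if i = 2 ∧ j = 0 ∧ k = 0 then -2 else 0) 0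
    (by intro v; rw [chr]; fin_cases i <;> fin_cases j <;> fin_cases k <;> simp) l u
  rw [key]
  fin_cases l <;> simp

/-- The leading-coefficient contravariant metric of the second (homogeneous third-order
Dubrovin–Novikov) Hamiltonian structure of the WDVV hydrodynamic-type system is symmetric,
everywhere invertible with determinant `−1`, and flat on all of `ℝ³`. -/
theorem second_hamiltonian_metric_of_wdvv_is_flat
    (G : (Fin 3 → ℝ) → Matrix (Fin 3) (Fin 3) ℝ)
    (hG : G = fun a => !![0, 0, 1;
                          0, 1, -a 0;
                          1, -a 0, (a 0) ^ 2 + 2 * a 1]) :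
    (∀ a : Fin 3 → ℝ, (G a).IsSymm) ∧
    (∀ a : Fin 3 → ℝ, (G a).det = -1) ∧
    (∀ (a : Fin 3 → ℝ) (i j k l : Fin 3), curvature G i j k l a = 0) := by
  have e : G = gw := hG
  subst e
  refine ⟨fun a => ?_, fun a => ?_, fun a i j k l => ?_⟩
  · ext i j
    fin_cases i <;> fin_cases j <;> simp [gw]
  · simp [gw, Matrix.det_fin_three]
  · unfold curvature
    simp only [pd_chr, chr, Fin.sum_univ_three]
    fin_cases i <;> fin_cases j <;> fin_cases k <;> fin_cases l <;> simp
end
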